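/- Let p be a prime with p ≥ 3 and let F be an LR-separated cellular automaton over ZMod p with leftmost position ℓ and rightmost position r, so the local rule is f(x_1,…,x_{d+1}) = a_ℓ x_ℓ^{q_ℓ} + π(x_{ℓ+1},…,x_{r−1}) + a_r x_r^{q_r} with a_ℓ, a_r ≠ 0 and q_ℓ, q_r ≥ 1 (interpreted as f = a_ℓ x_ℓ^{q_ℓ} when ℓ = r). Then the global map F is bijective if and only if ℓ = r and gcd(q_ℓ, p−1) = 1. -/

import Mathlib

/-- The global map of the cellular automaton over `ZMod m` with diameter `d`
and local rule `f : (ZMod m)^{d+1} → ZMod m`: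
`F(x)_i = f(x_i, x_{i+1}, …, x_{i+d})`. -/
def globalMap (m d : ℕ) (f : (Fin (d + 1) → ZMod m) → ZMod m)
    (x : ℤ → ZMod m) : ℤ → ZMod m :=
  fun i => f fun k => x (i + ((k : ℕ) : ℤ))

/-- `f` is an `LR`-separated local rule with leftmost position `ℓ`, rightmost
position `r`, leftmost/rightmost coefficients `aℓ, ar` and exponents `qℓ, qr`:
either `ℓ = r` and `f(x) = aℓ * x_ℓ ^ qℓ`, or `ℓ < r` and
`f(x) = aℓ * x_ℓ ^ qℓ + π(x_{ℓ+1},…,x_{r-1}) + ar * x_r ^ qr` for some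
arbitrary map `π` of the `r - ℓ - 1` intermediate variables. -/
def LRSeparated (m d : ℕ) (f : (Fin (d + 1) → ZMod m) → ZMod m)
    (ℓ r : Fin (d + 1)) (aℓ ar : ZMod m) (qℓ qr : ℕ) : Prop :=
  aℓ ≠ 0 ∧ ar ≠ 0 ∧ 1 ≤ qℓ ∧ 1 ≤ qr ∧
    ((ℓ = r ∧ ∀ x, f x = aℓ * x ℓ ^ qℓ) ∨
      (ℓ < r ∧ ∃ π : ({i : Fin (d + 1) // ℓ < i ∧ i < r} → ZMod m) → ZMod m,
        ∀ x, f x = aℓ * x ℓ ^ qℓ + π (fun i => x i.1) + ar * x r ^ qr))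

/-- An integer function on `ZMod p` with a vanishing nontrivial Fourier coefficient is constant. -/
lemma eq_of_sum_mul_stdAddChar_eq_zero {p : ℕ} [hp : Fact p.Prime] (c : ZMod p → ℤ)
    (h : ∑ z, (c z : ℂ) * ZMod.stdAddChar z = 0) (z w : ZMod p) : c z = c w := by
  have hζ : IsPrimitiveRoot (ZMod.stdAddChar (1 : ZMod p)) p := by
    have := Complex.isPrimitiveRoot_exp p hp.out.ne_zero
    have h1 := ZMod.stdAddChar_coe (N := p) 1
    rw [Int.cast_one, Int.cast_one, mul_one] at h1
    rwa [h1]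
  have hpow (z : ZMod p) : ZMod.stdAddChar z = (ZMod.stdAddChar (1 : ZMod p)) ^ z.val := by
    rw [← AddChar.map_nsmul_eq_pow, nsmul_one, ZMod.natCast_zmod_val]
  obtain ⟨n, rfl⟩ : ∃ n, p = n + 1 := ⟨p - 1, by have := hp.out.pos; omega⟩
  rw [Finset.sum_congr rfl fun z _ => congrArg _ (hpow z)] at h
  exact (hζ.sum_eq_zero_iff_forall_eq_int hp.out c).1 h z w

/-- If translating `σ` by a non-injective `Q` with a singleton fibre and summing yields a positive
constant, then `σ` is positive everywhere. -/
lemma pos_of_sum_sub_eq_const {p : ℕ} [hp : Fact p.Prime] {Q : ZMod p → ZMod p}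
    (hQ0 : ∀ z, Q z = 0 ↔ z = 0) (hQ : ¬ Function.Injective Q) (σ : ZMod p → ℕ) {C : ℕ}
    (hC : 0 < C) (hσ : ∀ s, ∑ z, σ (s - Q z) = C) (s : ZMod p) : 0 < σ s := by
  classical
  have hprim := ZMod.isPrimitive_stdAddChar p
  have hQne : ∑ z, ZMod.stdAddChar (Q z) ≠ 0 := by
    intro h
    apply hQ
    let κ : ZMod p → ℕ := fun y => ({z | Q z = y} : Finset (ZMod p)).card
    have hκ : ∑ y, ((κ y : ℤ) : ℂ) * ZMod.stdAddChar y = 0 := by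
      rw [← h, ← Finset.sum_fiberwise (s := Finset.univ) (g := Q)
        (f := fun z => ZMod.stdAddChar (Q z))]
      refine Finset.sum_congr rfl fun y _ => ?_
      rw [Finset.sum_congr rfl (g := fun _ => ZMod.stdAddChar y)
        (fun z hz => congrArg _ (Finset.mem_filter.1 hz).2)]
      simp [κ]
    have hκ0 : κ 0 = 1 := by
      simp only [κ, hQ0]
      exact Finset.card_eq_one.2 ⟨0, by ext; simp⟩
    intro z w hzw
    have h1 : κ (Q z) = 1 := by
      rw [← hκ0]
      exact_mod_cast eq_of_sum_mul_stdAddChar_eq_zero (fun y => (κ y : ℤ)) hκ _ _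
    exact Finset.card_le_one.1 h1.le z (by simp) w (by simp [hzw])
  have hzero : ∑ z, ((σ z : ℤ) : ℂ) * ZMod.stdAddChar z = 0 := by
    have h1 : (∑ s, (σ s : ℂ) * ZMod.stdAddChar s) * ∑ z, ZMod.stdAddChar (Q z) = 0 := by
      rw [Finset.mul_sum]
      have h2 (z : ZMod p) : (∑ s, (σ s : ℂ) * ZMod.stdAddChar s) * ZMod.stdAddChar (Q z) =
          ∑ s, (σ (s - Q z) : ℂ) * ZMod.stdAddChar s := by
        rw [Finset.sum_mul, ← (Equiv.subRight (Q z)).sum_comp]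
        refine Finset.sum_congr rfl fun s _ => ?_
        rw [mul_assoc, ← AddChar.map_add_eq_mul]
        simp
      simp_rw [h2]
      rw [Finset.sum_comm]
      simp_rw [← Finset.sum_mul, ← Nat.cast_sum, hσ]
      rw [← Finset.mul_sum, AddChar.sum_eq_zero_of_ne_one, mul_zero]
      simpa using hprim one_ne_zero
    simpa using (mul_eq_zero.1 h1).resolve_right hQne
  have hconst (z : ZMod p) : σ z = σ s := by
    exact_mod_cast eq_of_sum_mul_stdAddChar_eq_zero (fun z => (σ z : ℤ)) hzero z s
  have := hσ 0
  simp_rw [hconst] at this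
  by_contra h0
  simp only [not_lt, nonpos_iff_eq_zero] at h0
  simp [h0] at this
  omega

/-- On `ZMod p`, the `q`-th power map is injective iff `q` is coprime to `p - 1`. -/
lemma ZMod.pow_injective_iff {p : ℕ} [hp : Fact p.Prime] {q : ℕ} (hq : 1 ≤ q) :
    Function.Injective (fun z : ZMod p => z ^ q) ↔ Nat.gcd q (p - 1) = 1 := by
  have hcard : Nat.card (ZMod p)ˣ = p - 1 := by
    rw [Nat.card_eq_fintype_card, ZMod.card_units]
  constructor
  · intro hinj
    by_contra hne
    obtain ⟨l, hl, hdvd⟩ := Nat.exists_prime_and_dvd hne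
    have := Fact.mk hl
    obtain ⟨ζ, hζ⟩ := exists_prime_orderOf_dvd_card' (G := (ZMod p)ˣ) l
      (hcard ▸ hdvd.trans (Nat.gcd_dvd_right _ _))
    have h1 : ζ ^ q = 1 :=
      orderOf_dvd_iff_pow_eq_one.1 (hζ ▸ hdvd.trans (Nat.gcd_dvd_left _ _))
    have h2 : (ζ : ZMod p) = 1 := hinj (by
      simpa using congrArg Units.val h1)
    rw [Units.val_eq_one] at h2
    rw [h2, orderOf_one] at hζ
    exact hl.one_lt.ne hζ
  · intro hcop z w hzw
    have hq0 : q ≠ 0 := by omega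
    simp only at hzw
    by_cases hz : z = 0
    · subst hz
      rw [zero_pow hq0] at hzw
      exact (pow_eq_zero_iff hq0 |>.1 hzw.symm).symm
    · have hw : w ≠ 0 := by
        rintro rfl
        rw [zero_pow hq0] at hzw
        exact hz (pow_eq_zero_iff hq0 |>.1 hzw)
      have hb := (Nat.Coprime.pow_left_bijective (G := (ZMod p)ˣ) (n := q)
        (by rw [hcard]; exact Nat.coprime_comm.1 hcop)).injective
      have : Units.mk0 z hz = Units.mk0 w hw := hb (Units.ext (by simpa using hzw))
      simpa using congrArg Units.val this

/-- An injective cellular automaton has an inverse with finite window. -/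
lemma exists_window_of_injective {m d : ℕ} [NeZero m] {f : (Fin (d + 1) → ZMod m) → ZMod m}
    (hf : Function.Injective (globalMap m d f)) :
    ∃ K : ℕ, ∀ u v : ℤ → ZMod m,
      (∀ i : ℤ, -K ≤ i → i < K → globalMap m d f u i = globalMap m d f v i) → u 0 = v 0 := by
  by_contra! hcon
  have hcont (i : ℤ) : Continuous fun x => globalMap m d f x i :=
    continuous_of_discreteTopology.comp (continuous_pi fun k => continuous_apply _)
  let Z : ℕ → Set ((ℤ → ZMod m) × (ℤ → ZMod m)) := fun K =>
    {w | (∀ i : ℤ, -K ≤ i → i < K → globalMap m d f w.1 i = globalMap m d f w.2 i) ∧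
      w.1 0 ≠ w.2 0}
  have hclosed (K : ℕ) : IsClosed (Z K) := by
    have hZ : Z K = (⋂ i : ℤ, ⋂ _ : -(K : ℤ) ≤ i, ⋂ _ : i < K,
        {w | globalMap m d f w.1 i = globalMap m d f w.2 i}) ∩ {w | w.1 0 ≠ w.2 0} := by
      ext
      simp [Z]
    rw [hZ]
    refine IsClosed.inter ?_ ?_
    · exact isClosed_iInter fun i => isClosed_iInter fun _ => isClosed_iInter fun _ =>
        isClosed_eq ((hcont i).comp continuous_fst) ((hcont i).comp continuous_snd)
    · have : Continuous fun w : (ℤ → ZMod m) × (ℤ → ZMod m) => (w.1 0, w.2 0) := by fun_prop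
      exact (isClosed_discrete {a : ZMod m × ZMod m | a.1 ≠ a.2}).preimage this
  obtain ⟨⟨u, v⟩, huv⟩ := IsCompact.nonempty_iInter_of_sequence_nonempty_isCompact_isClosed Z
    (fun K w hw => ⟨fun i h1 h2 => hw.1 i (by push_cast; omega) (by push_cast; omega), hw.2⟩)
    (fun K => let ⟨u, v, h1, h2⟩ := hcon K; ⟨(u, v), h1, h2⟩) (hclosed 0).isCompact hclosed
  rw [Set.mem_iInter] at huv
  refine (huv 0).2 (congrFun (hf (funext fun i => ?_)) 0)
  exact (huv (i.natAbs + 1)).1 i (by omega) (by omega)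

/-- A map on bi-infinite configurations given by a translation-invariant rule on the cells of
`[l, r]`, additively separated in its two extreme cells. -/
structure IsSeparated {p : ℕ} (F : (ℤ → ZMod p) → ℤ → ZMod p) (l r : ℤ) (P Q : ZMod p → ZMod p)
    (φ : (ℤ → ZMod p) → ZMod p) : Prop where
  lt : l < r
  inner_congr : ∀ x y, (∀ j, l < j → j < r → x j = y j) → φ x = φ y
  apply_eq : ∀ x i, F x i = P (x (i + l)) + φ (fun j => x (i + j)) + Q (x (i + r))

namespace IsSeparated

variable {p : ℕ} {F : (ℤ → ZMod p) → ℤ → ZMod p} {l r : ℤ} {P Q : ZMod p → ZMod p}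
  {φ : (ℤ → ZMod p) → ZMod p}

lemma sub_right_congr (h : IsSeparated F l r P Q φ) {x y : ℤ → ZMod p} {i : ℤ}
    (hxy : ∀ j, i + l ≤ j → j < i + r → x j = y j) :
    F x i - Q (x (i + r)) = F y i - Q (y (i + r)) := by
  have := h.lt
  rw [h.apply_eq, h.apply_eq, hxy (i + l) le_rfl (by omega),
    h.inner_congr (fun j => x (i + j)) (fun j => y (i + j))
      fun j h1 h2 => hxy _ (by omega) (by omega)]
  ring

lemma sub_left_congr (h : IsSeparated F l r P Q φ) {x y : ℤ → ZMod p} {i : ℤ}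
    (hxy : ∀ j, i + l < j → j ≤ i + r → x j = y j) :
    F x i - P (x (i + l)) = F y i - P (y (i + l)) := by
  have := h.lt
  rw [h.apply_eq, h.apply_eq, hxy (i + r) (by omega) le_rfl,
    h.inner_congr (fun j => x (i + j)) (fun j => y (i + j))
      fun j h1 h2 => hxy _ (by omega) (by omega)]
  ring

lemma apply_congr (h : IsSeparated F l r P Q φ) {x y : ℤ → ZMod p} {i : ℤ}
    (hxy : ∀ j, i + l ≤ j → j ≤ i + r → x j = y j) : F x i = F y i := by
  have := h.lt
  have h1 := h.sub_right_congr fun j h1 h2 => hxy j h1 h2.le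
  rw [hxy (i + r) (by omega) le_rfl] at h1
  exact sub_left_injective h1

lemma apply_shift (h : IsSeparated F l r P Q φ) (x : ℤ → ZMod p) (n i : ℤ) :
    F (fun j => x (j + n)) i = F x (i + n) := by
  rw [h.apply_eq, h.apply_eq]
  simp only [add_right_comm]

/-- If the rule is permutive on the right, images can be prescribed on finitely many cells by
changing the configuration only to the right. -/
lemma exists_extend_right (h : IsSeparated F l r P Q φ) (hQ : Function.Surjective Q)
    (x y : ℤ → ZMod p) (c : ℤ) (N : ℕ) :
    ∃ x' : ℤ → ZMod p, (∀ j < c + r, x' j = x j) ∧ ∀ i, c ≤ i → i < c + N → F x' i = y i := by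
  have hlt := h.lt
  induction N with
  | zero => exact ⟨x, fun _ _ => rfl, fun i h1 h2 => by push_cast at h2; omega⟩
  | succ N ih =>
    obtain ⟨x', hx, hy⟩ := ih
    obtain ⟨b, hb⟩ := hQ (y (c + N) - (F x' (c + N) - Q (x' (c + N + r))))
    refine ⟨Function.update x' (c + N + r) b, fun j hj => ?_, fun i h1 h2 => ?_⟩
    · rw [Function.update_of_ne (by omega), hx j hj]
    · push_cast at h2
      rcases (show i < c + N ∨ i = c + N by omega) with hi | rfl
      · rw [← hy i h1 hi]
        exact h.apply_congr fun j _ _ => Function.update_of_ne (by omega) _ _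
      · have := h.sub_right_congr (x := Function.update x' (c + N + r) b) (y := x') (i := c + N)
          fun j _ _ => Function.update_of_ne (by omega) _ _
        rw [Function.update_self, hb] at this
        linear_combination this

/-- A rule which is permutive on the right cannot have an inverse with finite window. -/
lemma false_of_surjective_right [Fact p.Prime] (h : IsSeparated F l r P Q φ)
    (hQ : Function.Surjective Q) (hP0 : P 0 = 0) (hP1 : P 1 ≠ 0) (β : ℤ) (k : ℕ)
    (hdet : ∀ u v : ℤ → ZMod p, (∀ i, 1 - r - k ≤ i → i < β → F u i = F v i) → u 0 = v 0) :
    False := by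
  have hlt := h.lt
  induction k with
  | zero =>
    obtain ⟨x', hx, hy⟩ := h.exists_extend_right hQ (fun _ => 1) (F fun _ => 0) (1 - r)
      (β - (1 - r)).toNat
    have h1 := hdet x' (fun _ => 0) fun i h1 h2 => hy i (by push_cast at h1; omega) (by omega)
    rw [hx 0 (by omega)] at h1
    exact one_ne_zero h1
  | succ k ih =>
    apply ih
    set c : ℤ := 1 - r - (k + 1 : ℕ) with hc
    have key (t : ℕ) : ∀ u v : ℤ → ZMod p, (∀ i, c < i → i < β → F u i = F v i) →
        F v c = F u c + t * P 1 → u 0 = v 0 := by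
      induction t with
      | zero =>
        intro u v huv h0
        refine hdet u v fun i h1 h2 => ?_
        rcases h1.eq_or_lt with rfl | h1
        · simpa using h0.symm
        · exact huv i h1 h2
      | succ t iht =>
        intro u v huv h0
        obtain ⟨x, hx, hy⟩ := h.exists_extend_right hQ (Function.update u (c + l) 0) (F u) c
          ((β - c).toNat + 1)
        have hxl : x (c + l) = 0 := by rw [hx _ (by omega), Function.update_self]
        have hux : u 0 = x 0 := hdet u x fun i h1 h2 => (hy i h1 (by omega)).symm
        set x' := Function.update x (c + l) 1 with hx'
        have hx'0 : x' 0 = x 0 := Function.update_of_ne (by push_cast at hc; omega) _ _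
        have hsub := h.sub_left_congr (x := x') (y := x) (i := c)
          fun j _ _ => Function.update_of_ne (by omega) _ _
        rw [hxl, hx', Function.update_self, ← hx', hP0] at hsub
        rw [hux, ← hx'0]
        refine iht x' v (fun i h1 h2 => ?_) ?_
        · rw [← huv i h1 h2, ← hy i h1.le (by omega)]
          exact h.apply_congr fun j _ _ => Function.update_of_ne (by omega) _ _
        · rw [hy c le_rfl (by omega)] at hsub
          push_cast at h0
          linear_combination h0 - hsub
    intro u v huv
    refine key ((F v c - F u c) * (P 1)⁻¹).val u v (fun i h1 h2 => huv i ?_ h2) ?_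
    · push_cast at hc; omega
    · rw [ZMod.natCast_zmod_val]
      field_simp
      ring

/-- If the rule is injective but not permutive on the right, then any finite pattern of images
ending at the cell `c` is attained by a configuration vanishing at `c + r`. -/
lemma exists_apply_eq_and_eq_zero [Fact p.Prime] (h : IsSeparated F l r P Q φ)
    (hF : Function.Injective F) (hQ0 : ∀ z, Q z = 0 ↔ z = 0) (hQ : ¬ Function.Injective Q)
    (u : ℤ → ZMod p) (α c : ℤ) :
    ∃ x : ℤ → ZMod p, (∀ i, α ≤ i → i ≤ c → F x i = F u i) ∧ x (c + r) = 0 := by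
  classical
  have hlt := h.lt
  obtain ⟨n, hn0, hn1, hn2, hn3⟩ : ∃ n : ℕ, n ≠ 0 ∧ c + r - α - l < n ∧ r - l < n ∧ c - α < n :=
    ⟨(c + r - α - l).toNat + (r - l).toNat + (c - α).toNat + 1, by omega, by omega, by omega,
      by omega⟩
  have := NeZero.mk hn0
  have hne {i j : ℤ} (h1 : i < j) (h2 : j - i < n) : (i : ZMod n) ≠ j := by
    rw [Ne, ZMod.intCast_eq_intCast_iff_dvd_sub]
    exact fun hd => by have := Int.le_of_dvd (by omega) hd; omega
  -- the induced bijection of `n`-periodic configurations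
  let per : (ZMod n → ZMod p) → ℤ → ZMod p := fun w j => w j
  let Fn : (ZMod n → ZMod p) → ZMod n → ZMod p := fun w k => F (per w) k.val
  have hFn (w i) : F (per w) i = Fn w i := by
    have h1 : (fun j => per w (j + n * (i / n))) = per w := by
      funext j
      simp [per]
    have h2 := h.apply_shift (per w) (n * (i / n)) (i % n)
    rw [h1, Int.emod_add_mul_ediv] at h2
    simp only [Fn, ZMod.val_intCast, h2]
  have hinj : Function.Injective Fn := by
    intro w w' hw
    have h1 : per w = per w' := hF (funext fun i => by rw [hFn, hFn, hw])
    funext k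
    have := congrFun h1 k.val
    simpa [per] using this
  let E := Equiv.ofBijective Fn (Finite.injective_iff_bijective.1 hinj)
  let M : ZMod p → Finset (ZMod n → ZMod p) := fun s =>
    {y | (∀ i : ℤ, α ≤ i → i < c → y i = F u i) ∧ y c = s}
  let N : ZMod p → Finset (ZMod n → ZMod p) := fun s =>
    {w | (∀ i : ℤ, α ≤ i → i < c → F (per w) i = F u i) ∧ F (per w) c = s}
  have hNM (s) : (N s).card = (M s).card :=
    Finset.card_equiv E fun w => by simp [N, M, E, hFn]
  have hMle (s s') : (M s).card ≤ (M s').card := by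
    refine Finset.card_le_card_of_injOn (fun y => Function.update y (c : ZMod n) s') ?_ ?_
    · intro y hy
      simp only [M, Finset.coe_filter, Finset.mem_univ, true_and, Set.mem_ofPred_eq] at hy ⊢
      refine ⟨fun i h1 h2 => ?_, Function.update_self _ _ _⟩
      rw [Function.update_of_ne (hne h2 (by omega)), hy.1 i h1 h2]
    · intro y hy y' hy' heq
      simp only [M, Finset.coe_filter, Finset.mem_univ, true_and, Set.mem_ofPred_eq] at hy hy'
      funext k
      by_cases hk : k = c
      · rw [hk, hy.2, hy'.2]
      · simpa [Function.update_of_ne hk] using congrFun heq k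
  have hM0 : 0 < (M 0).card := by
    obtain ⟨y, hy⟩ : ∃ y : ZMod n → ZMod p, ∀ i : ℤ, α ≤ i → i < c → y i = F u i := by
      refine ⟨fun k => F u (α + ((k - α : ZMod n).val : ℤ)), fun i h1 h2 => ?_⟩
      have : (((i : ZMod n) - α).val : ℤ) = i - α := by
        rw [← Int.cast_sub, ZMod.val_intCast, Int.emod_eq_of_lt (by omega) (by omega)]
      simp only [this]
      congr 1
      ring
    exact (Finset.card_pos.2 ⟨y, by simpa [M] using hy⟩).trans_le (hMle (y c) 0)
  have hupd (w : ZMod n → ZMod p) (z : ZMod p) (j : ℤ) (h1 : j < c + r)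
      (h2 : α + l ≤ j ∨ c + l ≤ j) :
      per (Function.update w ((c + r : ℤ) : ZMod n) z) j = per w j :=
    Function.update_of_ne (hne h1 (by omega)) _ _
  have hupd_lt (w : ZMod n → ZMod p) (z : ZMod p) (i : ℤ) (h1 : α ≤ i) (h2 : i < c) :
      F (per (Function.update w ((c + r : ℤ) : ZMod n) z)) i = F (per w) i :=
    h.apply_congr fun j _ _ => hupd w z j (by omega) (by omega)
  have hupd_eq (w : ZMod n → ZMod p) (z : ZMod p) :
      F (per (Function.update w ((c + r : ℤ) : ZMod n) z)) c - Q z =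
        F (per w) c - Q (w ((c + r : ℤ) : ZMod n)) := by
    have := h.sub_right_congr (i := c) fun j _ _ => hupd w z j (by omega) (by omega)
    simpa only [per, Function.update_self] using this
  let S : ZMod p → Finset (ZMod n → ZMod p) := fun s => {w ∈ N s | w ((c + r : ℤ) : ZMod n) = 0}
  have hQ00 : Q 0 = 0 := (hQ0 0).2 rfl
  have hS (s) : ∑ z, (S (s - Q z)).card = (M 0).card := by
    rw [← (hMle s 0).antisymm (hMle 0 s), ← hNM, Finset.card_eq_sum_card_fiberwise
      (f := fun w : ZMod n → ZMod p => w ((c + r : ℤ) : ZMod n)) (t := Finset.univ) (by simp)]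
    refine Finset.sum_congr rfl fun z _ => ?_
    refine Finset.card_bij' (fun w _ => Function.update w ((c + r : ℤ) : ZMod n) z)
      (fun w _ => Function.update w ((c + r : ℤ) : ZMod n) 0) ?_ ?_ ?_ ?_
    · intro w hw
      simp only [S, N, Finset.mem_filter, Finset.mem_univ, true_and] at hw ⊢
      refine ⟨⟨fun i h1 h2 => (hupd_lt w z i h1 h2).trans (hw.1.1 i h1 h2), ?_⟩,
        Function.update_self _ _ _⟩
      have := hupd_eq w z
      rw [hw.1.2, hw.2, hQ00] at this
      linear_combination this
    · intro w hw
      simp only [S, N, Finset.mem_filter, Finset.mem_univ, true_and] at hw ⊢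
      refine ⟨⟨fun i h1 h2 => (hupd_lt w 0 i h1 h2).trans (hw.1.1 i h1 h2), ?_⟩,
        Function.update_self _ _ _⟩
      have := hupd_eq w 0
      rw [hw.1.2, hw.2, hQ00] at this
      linear_combination this
    · intro w hw
      simp only [S, Finset.mem_filter] at hw
      simp [← hw.2]
    · intro w hw
      simp only [Finset.mem_filter] at hw
      simp [← hw.2]
  obtain ⟨w, hw⟩ := Finset.card_pos.1
    (pos_of_sum_sub_eq_const hQ0 hQ (fun s => (S s).card) hM0 hS (F u c))
  simp only [S, N, Finset.mem_filter, Finset.mem_univ, true_and] at hw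
  refine ⟨per w, fun i h1 h2 => ?_, hw.2⟩
  rcases h2.eq_or_lt with rfl | h2
  · exact hw.1.2
  · exact hw.1.1 i h1 h2

/-- An injective rule which is not permutive on the right cannot have an inverse with finite
window. -/
lemma false_of_not_injective_right [Fact p.Prime] (h : IsSeparated F l r P Q φ)
    (hF : Function.Injective F) (hQ0 : ∀ z, Q z = 0 ↔ z = 0) (hQ : ¬ Function.Injective Q)
    (α : ℤ) (k : ℕ)
    (hdet : ∀ u v : ℤ → ZMod p, (∀ i, α ≤ i → i < 1 - r + k → F u i = F v i) → u 0 = v 0) :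
    False := by
  have hlt := h.lt
  have hQ00 : Q 0 = 0 := (hQ0 0).2 rfl
  have hQ1 : Q 1 ≠ 0 := fun h1 => one_ne_zero ((hQ0 1).1 h1)
  induction k with
  | zero =>
    apply hQ
    intro z w hzw
    have := hdet (Function.update 0 0 z) (Function.update 0 0 w) fun i _ h2 => by
      have hi := h.sub_right_congr (x := Function.update 0 0 z) (y := Function.update 0 0 w) (i := i)
        fun j _ _ => by
          push_cast at h2
          rw [Function.update_of_ne (by omega), Function.update_of_ne (by omega)]
      have hir : Q (Function.update (0 : ℤ → ZMod p) 0 z (i + r)) =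
          Q (Function.update (0 : ℤ → ZMod p) 0 w (i + r)) := by
        by_cases h0 : i + r = 0
        · simp only [h0, Function.update_self, hzw]
        · rw [Function.update_of_ne h0, Function.update_of_ne h0]
      rw [hir] at hi
      exact sub_left_injective hi
    simpa using this
  | succ k ih =>
    apply ih
    set c : ℤ := 1 - r + k with hc
    have key (t : ℕ) : ∀ u v : ℤ → ZMod p, (∀ i, α ≤ i → i < c → F u i = F v i) →
        F v c = F u c + t * Q 1 → u 0 = v 0 := by
      induction t with
      | zero =>
        intro u v huv h0
        refine hdet u v fun i h1 h2 => ?_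
        rcases (show i < c ∨ i = c by push_cast at h2; omega) with h2 | rfl
        · exact huv i h1 h2
        · simpa using h0.symm
      | succ t iht =>
        intro u v huv h0
        obtain ⟨x, hx, hxr⟩ := h.exists_apply_eq_and_eq_zero hF hQ0 hQ u (min α c) c
        have hux : u 0 = x 0 := hdet u x fun i h1 h2 =>
          (hx i (by omega) (by push_cast at h2; omega)).symm
        set x' := Function.update x (c + r) 1 with hx'
        have hx'0 : x' 0 = x 0 := Function.update_of_ne (by omega) _ _
        have hsub := h.sub_right_congr (x := x') (y := x) (i := c)
          fun j _ _ => Function.update_of_ne (by omega) _ _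
        rw [hxr, hx', Function.update_self, ← hx', hQ00, hx c (by omega) le_rfl] at hsub
        rw [hux, ← hx'0]
        refine iht x' v (fun i h1 h2 => ?_) ?_
        · rw [← huv i h1 h2, ← hx i (by omega) h2.le]
          exact h.apply_congr fun j _ _ => Function.update_of_ne (by omega) _ _
        · push_cast at h0
          linear_combination h0 - hsub
    intro u v huv
    refine key ((F v c - F u c) * (Q 1)⁻¹).val u v huv ?_
    rw [ZMod.natCast_zmod_val]
    field_simp
    ring

end IsSeparated

/-- A local rule which is separated in two distinct cells does not induce an injective map. -/
lemma not_injective_globalMap_of_lt {p d : ℕ} [Fact p.Prime]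
    {f : (Fin (d + 1) → ZMod p) → ZMod p} {l r : Fin (d + 1)} {a b : ZMod p} {q q' : ℕ}
    (ha : a ≠ 0) (hb : b ≠ 0) (hq : 1 ≤ q) (hq' : 1 ≤ q') (hlr : l < r)
    (π : ({i : Fin (d + 1) // l < i ∧ i < r} → ZMod p) → ZMod p)
    (hf : ∀ x, f x = a * x l ^ q + π (fun i => x i.1) + b * x r ^ q') :
    ¬ Function.Injective (globalMap p d f) := by
  intro hinj
  obtain ⟨K, hK⟩ := exists_window_of_injective hinj
  have hsep : IsSeparated (globalMap p d f) ((l : ℕ) : ℤ) ((r : ℕ) : ℤ) (fun z => a * z ^ q)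
      (fun z => b * z ^ q') (fun x => π fun i => x ((i.1 : ℕ) : ℤ)) := by
    refine ⟨by exact_mod_cast hlr, fun x y hxy => congrArg π <| funext fun i => ?_,
      fun x i => hf _⟩
    exact hxy _ (by exact_mod_cast i.2.1) (by exact_mod_cast i.2.2)
  have hq0 : q ≠ 0 := by omega
  have hq0' : q' ≠ 0 := by omega
  by_cases hQ : Function.Injective fun z : ZMod p => b * z ^ q'
  · exact hsep.false_of_surjective_right (Finite.injective_iff_surjective.1 hQ) (by simp [hq0])
      (by simpa using ha) K (K + 1) fun u v huv => hK u v fun i h1 h2 => huv i (by omega) h2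
  · exact hsep.false_of_not_injective_right hinj (by simp [hb, hq0']) hQ (-K) (K + (r : ℕ))
      fun u v huv => hK u v fun i h1 h2 => huv i h1 (by push_cast; omega)

/-- A local rule reading a single cell `l` induces a bijection iff it is injective in that cell. -/
lemma bijective_globalMap_iff_of_single {m d : ℕ} [NeZero m] {f : (Fin (d + 1) → ZMod m) → ZMod m}
    {l : Fin (d + 1)} {P : ZMod m → ZMod m} (hf : ∀ x, f x = P (x l)) :
    Function.Bijective (globalMap m d f) ↔ Function.Injective P := by
  have hF (x i) : globalMap m d f x i = P (x (i + (l : ℕ))) := hf _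
  constructor
  · intro hb z w hzw
    have : (fun _ : ℤ => z) = fun _ => w := hb.injective (funext fun i => by rw [hF, hF, hzw])
    exact congrFun this 0
  · intro hP
    refine ⟨fun x y hxy => funext fun i => hP ?_, fun y => ?_⟩
    · have := congrFun hxy (i - (l : ℕ))
      rwa [hF, hF, sub_add_cancel] at this
    · choose g hg using Finite.injective_iff_surjective.1 hP
      exact ⟨fun i => g (y (i - (l : ℕ))), funext fun i => by rw [hF, hg, add_sub_cancel_right]⟩

/-- Let `p ≥ 3` be prime and `F` an `LR`-separated CA over `ZMod p` with
leftmost position `ℓ` and rightmost position `r`.  Then `F` is bijective iff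
`ℓ = r` and `gcd(qℓ, p - 1) = 1`. -/
theorem LRseparated_bijective_iff
    (p : ℕ) (hp : p.Prime) (hp3 : 3 ≤ p) (d : ℕ)
    (f : (Fin (d + 1) → ZMod p) → ZMod p)
    (ℓ r : Fin (d + 1)) (aℓ ar : ZMod p) (qℓ qr : ℕ)
    (hsep : LRSeparated p d f ℓ r aℓ ar qℓ qr) :
    Function.Bijective (globalMap p d f) ↔
      ℓ = r ∧ Nat.gcd qℓ (p - 1) = 1 := by
  have := Fact.mk hp
  obtain ⟨hl, hr, hql, hqr, ⟨hlr, hf⟩ | ⟨hlr, π, hf⟩⟩ := hsep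
  · rw [bijective_globalMap_iff_of_single (P := fun z => aℓ * z ^ qℓ) hf,
      ← ZMod.pow_injective_iff hql, and_iff_right hlr]
    exact (mul_right_injective₀ hl).of_comp_iff fun z : ZMod p => z ^ qℓ
  · exact iff_of_false
      (fun hb => not_injective_globalMap_of_lt hl hr hql hqr hlr π hf hb.injective)
      fun h => hlr.ne h.1
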